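/- (4,2)-hypercontractivity for T_{1/√3}: for every f : {-1,1}^n → ℝ, ‖T_{1/√3} f‖_4 ≤ ‖f‖_2, i.e., E_x[(T_{1/√3} f)(x)^4] ≤ (E_x[f(x)^2])^2. -/

import Mathlib

open Finset

/-- The real value of a cube coordinate: `true ↦ 1`, `false ↦ -1`. -/
noncomputable def bR (b : Bool) : ℝ := if b then 1 else -1

/-- Expectation over a uniformly random point of the cube `{-1,1}ⁿ`. -/
noncomputable def expect {n : ℕ} (g : (Fin n → Bool) → ℝ) : ℝ :=
  (∑ x : Fin n → Bool, g x) / 2 ^ n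

/-- The character `χ_S(x) = ∏_{i ∈ S} x i`. -/
noncomputable def chi {n : ℕ} (S : Finset (Fin n)) (x : Fin n → Bool) : ℝ :=
  ∏ i ∈ S, bR (x i)

/-- The Fourier coefficient `f̂(S) = E[f(x) χ_S(x)]`. -/
noncomputable def fhat {n : ℕ} (f : (Fin n → Bool) → ℝ) (S : Finset (Fin n)) : ℝ :=
  expect fun x => f x * chi S x

/-- The noise operator `T_ρ` as an integral operator with product kernel. -/
noncomputable def noise {n : ℕ} (ρ : ℝ) (f : (Fin n → Bool) → ℝ) (x : Fin n → Bool) : ℝ :=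
  expect fun y => f y * ∏ i, (1 + ρ * bR (x i) * bR (y i))

lemma sum_fourier_eq_noise {n : ℕ} (ρ : ℝ) (f : (Fin n → Bool) → ℝ) (x : Fin n → Bool) :
    ∑ S : Finset (Fin n), ρ ^ S.card * fhat f S * chi S x = noise ρ f x := by
  simp only [noise, fhat, _root_.expect, Finset.prod_one_add, chi, Finset.powerset_univ,
    Finset.prod_mul_distrib, Finset.prod_const, Finset.mul_sum, Finset.sum_mul, Finset.sum_div]
  rw [Finset.sum_comm]
  refine Finset.sum_congr rfl fun y _ => Finset.sum_congr rfl fun S _ => ?_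
  ring

lemma expect_succ {n : ℕ} (g : (Fin (n + 1) → Bool) → ℝ) :
    expect g = expect fun x : Fin n → Bool =>
      (g (Fin.cons true x) + g (Fin.cons false x)) / 2 := by
  simp only [_root_.expect]
  rw [← (Fin.consEquiv fun _ : Fin (n + 1) => Bool).sum_comp, Fintype.sum_prod_type]
  simp only [Fintype.sum_bool, Fin.consEquiv, Equiv.coe_fn_mk]
  rw [← Finset.sum_div, Finset.sum_add_distrib, pow_succ]
  field_simp

lemma expect_add {n : ℕ} (g h : (Fin n → Bool) → ℝ) :
    (expect fun x => g x + h x) = expect g + expect h := by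
  simp only [_root_.expect, Finset.sum_add_distrib, add_div]

lemma expect_const_mul {n : ℕ} (c : ℝ) (g : (Fin n → Bool) → ℝ) :
    (expect fun x => c * g x) = c * expect g := by
  simp only [_root_.expect, ← Finset.mul_sum, mul_div_assoc]

lemma expect_nonneg {n : ℕ} {g : (Fin n → Bool) → ℝ} (hg : ∀ x, 0 ≤ g x) : 0 ≤ expect g :=
  div_nonneg (Finset.sum_nonneg fun x _ => hg x) (by positivity)

lemma expect_mul_sq_le {n : ℕ} (g h : (Fin n → Bool) → ℝ) :
    (expect fun x => g x * h x) ^ 2 ≤ (expect fun x => g x ^ 2) * expect fun x => h x ^ 2 := by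
  simp only [_root_.expect]
  rw [div_pow, div_mul_div_comm, ← sq]
  gcongr
  exact Finset.sum_mul_sq_le_sq_mul_sq _ _ _

/-- Splitting off the first coordinate: the noise operator acts on the even and odd parts of `f`. -/
lemma noise_cons {n : ℕ} (ρ : ℝ) (f : (Fin (n + 1) → Bool) → ℝ) (b : Bool) (x : Fin n → Bool) :
    noise ρ f (Fin.cons b x) =
      noise ρ (fun y => (f (Fin.cons true y) + f (Fin.cons false y)) / 2) x +
      ρ * bR b * noise ρ (fun y => (f (Fin.cons true y) - f (Fin.cons false y)) / 2) x := by
  simp only [noise]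
  rw [expect_succ, ← expect_const_mul, ← expect_add]
  congr 1
  funext y
  simp only [Fin.prod_univ_succ, Fin.cons_zero, Fin.cons_succ]
  simp only [bR, if_true, Bool.false_eq_true, if_false]
  ring

lemma expect_noise_pow_four_le {ρ : ℝ} (hρ : ρ ^ 2 = 1 / 3) (n : ℕ) (f : (Fin n → Bool) → ℝ) :
    (expect fun x => noise ρ f x ^ 4) ≤ (expect fun x => f x ^ 2) ^ 2 := by
  induction n with
  | zero =>
    simp only [noise, _root_.expect, Fintype.sum_unique, Finset.univ_eq_empty, Finset.prod_empty]
    apply le_of_eq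
    ring
  | succ n ih =>
    set g : (Fin n → Bool) → ℝ := fun y => (f (Fin.cons true y) + f (Fin.cons false y)) / 2 with hg
    set h : (Fin n → Bool) → ℝ := fun y => (f (Fin.cons true y) - f (Fin.cons false y)) / 2 with hh
    have hL : (expect fun x => noise ρ f x ^ 4) =
        (expect fun x => noise ρ g x ^ 4) +
          (2 * (expect fun x => noise ρ g x ^ 2 * noise ρ h x ^ 2) +
            1 / 9 * expect fun x => noise ρ h x ^ 4) := by
      rw [expect_succ, ← expect_const_mul, ← expect_const_mul, ← expect_add, ← expect_add]
      congr 1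
      funext x
      rw [noise_cons, noise_cons, ← hg, ← hh]
      simp only [bR, if_true, Bool.false_eq_true, if_false]
      linear_combination (6 * noise ρ g x ^ 2 * noise ρ h x ^ 2 +
        noise ρ h x ^ 4 * (ρ ^ 2 + 1 / 3)) * hρ
    have hR : (expect fun x => f x ^ 2) =
        (expect fun x => g x ^ 2) + expect fun x => h x ^ 2 := by
      rw [expect_succ, ← expect_add]
      congr 1
      funext x
      simp only [hg, hh]
      ring
    have hA : 0 ≤ expect fun x => g x ^ 2 := expect_nonneg fun x => sq_nonneg _
    have hB : 0 ≤ expect fun x => h x ^ 2 := expect_nonneg fun x => sq_nonneg _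
    have hH : 0 ≤ expect fun x => noise ρ h x ^ 4 := expect_nonneg fun x => by positivity
    have hCS : (expect fun x => noise ρ g x ^ 2 * noise ρ h x ^ 2) ≤
        (expect fun x => g x ^ 2) * expect fun x => h x ^ 2 := by
      refine le_of_sq_le_sq ?_ (mul_nonneg hA hB)
      refine (expect_mul_sq_le _ _).trans ?_
      simp only [← pow_mul, Nat.reduceMul]
      rw [mul_pow]
      exact mul_le_mul (ih g) (ih h) hH (sq_nonneg _)
    rw [hL, hR]
    linarith [ih g, ih h]

/-- **(4,2)-hypercontractivity for `T_{1/√3}`.** For every `f : {-1,1}ⁿ → ℝ`,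
`‖T_{1/√3} f‖₄ ≤ ‖f‖₂`, i.e. `E[(T_{1/√3} f)⁴] ≤ (E[f²])²`, where
`(T_ρ f)(x) = ∑_S ρ^{|S|} f̂(S) χ_S(x)`. -/
theorem hypercontractivity_four_two (n : ℕ) (f : (Fin n → Bool) → ℝ) :
    (expect fun x : Fin n → Bool =>
        (∑ S : Finset (Fin n), (Real.sqrt 3)⁻¹ ^ S.card * fhat f S * chi S x) ^ 4) ≤
      (expect fun x => f x ^ 2) ^ 2 := by
  simp only [sum_fourier_eq_noise]
  exact expect_noise_pow_four_le (by rw [inv_pow, Real.sq_sqrt (by norm_num)]; norm_num) n f
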